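/- Let G be a group acting faithfully on a set A, and let s ∈ G. Suppose there is a chain of subgroups ⟨s⟩ = H₀ < H₁ < ⋯ < H_k < H_{k+1} = G together with elements g_i ∈ H_{i+1} (for 1 ≤ i ≤ k) such that for every 1 ≤ i ≤ k: (i) every group homomorphism from H_i to the additive group ℝ is trivial, and (ii) g_i(supp(H_i)) ∩ supp(H_i) = ∅ in A. Then for every complete CAT(0) space X of topological dimension k and every semi-simple isometric action of G on X, the element s has a fixed point in X. -/

import Mathlib

open Pointwise
open Set

/-- A geodesic from `x` to `y`, affinely parametrized on `[0,1]`. -/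
def IsGeodSeg {X : Type*} [MetricSpace X] (x y : X) (γ : ℝ → X) : Prop :=
  γ 0 = x ∧ γ 1 = y ∧
    ∀ s ∈ Icc (0:ℝ) 1, ∀ t ∈ Icc (0:ℝ) 1, dist (γ s) (γ t) = |s - t| * dist x y

/-- A CAT(0) space: a geodesic metric space all of whose geodesic triangles are no fatter
than Euclidean comparison triangles, expressed via the standard comparison inequality
`d(p, γ(t))² ≤ (1-t)·d(p,x)² + t·d(p,y)² - t(1-t)·d(x,y)²` for geodesics `γ` from `x` to `y`. -/
def IsCAT0 (X : Type*) [MetricSpace X] : Prop :=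
  (∀ x y : X, ∃ γ : ℝ → X, IsGeodSeg x y γ) ∧
    ∀ (p x y : X) (γ : ℝ → X), IsGeodSeg x y γ → ∀ t ∈ Icc (0:ℝ) 1,
      dist p (γ t) ^ 2 ≤
        (1 - t) * dist p x ^ 2 + t * dist p y ^ 2 - t * (1 - t) * dist x y ^ 2

/-- The covering dimension of `X` is at most `n`: every open cover admits an open
refinement covering `X` in which every point lies in at most `n + 1` members. -/
def DimLE (X : Type*) [TopologicalSpace X] (n : ℕ) : Prop :=
  ∀ 𝒰 : Set (Set X), (∀ U ∈ 𝒰, IsOpen U) → ⋃₀ 𝒰 = univ →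
    ∃ 𝒱 : Set (Set X), (∀ V ∈ 𝒱, IsOpen V) ∧ ⋃₀ 𝒱 = univ ∧
      (∀ V ∈ 𝒱, ∃ U ∈ 𝒰, V ⊆ U) ∧
      ∀ x : X, {V | V ∈ 𝒱 ∧ x ∈ V}.encard ≤ (n : ℕ∞) + 1

/-- The topological (covering) dimension of `X`, as an extended natural number. -/
noncomputable def covDim (X : Type*) [TopologicalSpace X] : ℕ∞ :=
  sInf {d : ℕ∞ | ∃ n : ℕ, d = (n : ℕ∞) ∧ DimLE X n}
/-- An isometric action `ρ : G → Isom(X)` is semi-simple if every element attains its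
translation length `inf_x d(x, g·x)` at some point of `X`. -/
def SemiSimpleAction {G : Type*} [Group G] {X : Type*} [MetricSpace X]
    (ρ : G →* (X ≃ᵢ X)) : Prop :=
  ∀ g : G, ∃ x : X, ∀ y : X, dist x (ρ g x) ≤ dist y (ρ g y)

/-- The support in `A` of a subgroup `H` of a group `G` acting on `A`. -/
def groupSupp {G : Type*} (A : Type*) [Group G] [MulAction G A] (H : Subgroup G) : Set A :=
  {a : A | ∃ h ∈ H, h • a ≠ a}

def kVert {m : ℕ} (v τ : Fin m → ℕ) (j : ℕ) : Fin m → ℕ :=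
  fun i => v i + if τ i < j then 1 else 0

def kCell {m : ℕ} (M d : ℕ) (v τ : Fin m → ℕ) : Prop :=
  (∀ i : Fin m, (i : ℕ) < d → v i < M) ∧ (∀ i : Fin m, d ≤ (i : ℕ) → v i = M) ∧
  (∀ i : Fin m, (i : ℕ) < d → τ i < d) ∧ (∀ i : Fin m, d ≤ (i : ℕ) → τ i = i) ∧
  Function.Injective τ

lemma kDoor_parity (d : ℕ) (a : ℕ → ℕ) (ha : ∀ j ≤ d, a j ≤ d) :
    (((Finset.range (d+1)).filter
      (fun j => ((Finset.range (d+1)).erase j).image a = Finset.range d)).card : ZMod 2) =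
    if (Finset.range (d+1)).image a = Finset.range (d+1) then 1 else 0 := by
  classical
  split_ifs with hf
  · have hinj : Set.InjOn a (Finset.range (d+1)) := by
      apply Finset.injOn_of_card_image_eq; rw [hf]
    obtain ⟨j0, hj0, haj0⟩ : ∃ j ∈ Finset.range (d+1), a j = d := by
      have : d ∈ (Finset.range (d+1)).image a := by rw [hf]; simp
      simpa using this
    have : ((Finset.range (d+1)).filter
      (fun j => ((Finset.range (d+1)).erase j).image a = Finset.range d)) = {j0} := by
      ext j
      simp only [Finset.mem_filter, Finset.mem_singleton]
      constructor
      · rintro ⟨hj, h⟩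
        by_contra hne
        have : d ∈ ((Finset.range (d+1)).erase j).image a :=
          Finset.mem_image.2 ⟨j0, Finset.mem_erase.2 ⟨fun h => hne h.symm, hj0⟩, haj0⟩
        rw [h] at this; simp at this
      · rintro rfl
        refine ⟨hj0, ?_⟩
        ext l
        simp only [Finset.mem_image, Finset.mem_erase, Finset.mem_range]
        constructor
        · rintro ⟨x, ⟨hx, hx'⟩, rfl⟩
          have := ha x (by omega)
          rcases lt_or_eq_of_le this with h | h
          · exact h
          · exact absurd (hinj (by simpa using hx') (by simpa using hj0) (h.trans haj0.symm)) hx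
        · intro hl
          have : l ∈ (Finset.range (d+1)).image a := by rw [hf]; simp; omega
          simp only [Finset.mem_image, Finset.mem_range] at this
          obtain ⟨x, hx, rfl⟩ := this
          exact ⟨x, ⟨fun h => by subst h; omega, hx⟩, rfl⟩
    rw [this]; simp
  · by_cases hex : ∃ j ∈ Finset.range (d+1), ((Finset.range (d+1)).erase j).image a = Finset.range d
    · obtain ⟨j0, hj0, h0⟩ := hex
      have hins : insert (a j0) (Finset.range d) = (Finset.range (d+1)).image a := by
        rw [← h0, ← Finset.image_insert, Finset.insert_erase hj0]
      have hlt : a j0 < d := by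
        rcases lt_or_eq_of_le (ha j0 (by simp at hj0; omega)) with h | h
        · exact h
        · exfalso; apply hf; rw [← hins, h, Finset.range_add_one]
      have hinj : Set.InjOn a ((Finset.range (d+1)).erase j0) := by
        apply Finset.injOn_of_card_image_eq; rw [h0, Finset.card_erase_of_mem hj0]; simp
      obtain ⟨j1, hj1, hj01⟩ : ∃ j ∈ (Finset.range (d+1)).erase j0, a j = a j0 := by
        have : a j0 ∈ ((Finset.range (d+1)).erase j0).image a := by rw [h0]; simpa using hlt
        simpa [and_assoc] using this
      have hne : j0 ≠ j1 := fun h => (Finset.mem_erase.1 hj1).1 h.symm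
      have hj1' := (Finset.mem_erase.1 hj1).2
      have : ((Finset.range (d+1)).filter
        (fun j => ((Finset.range (d+1)).erase j).image a = Finset.range d)) = {j0, j1} := by
        ext j
        simp only [Finset.mem_filter, Finset.mem_singleton, Finset.mem_insert]
        constructor
        · rintro ⟨hj, h⟩
          by_contra hcon
          push Not at hcon
          have : a j ∈ ((Finset.range (d+1)).erase j).image a := by
            rw [h, ← h0]
            exact Finset.mem_image_of_mem _ (Finset.mem_erase.2 ⟨hcon.1, hj⟩)
          obtain ⟨x, hx, hxa⟩ := Finset.mem_image.1 this
          obtain ⟨hx1, hx2⟩ := Finset.mem_erase.1 hx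
          by_cases hx0 : x = j0
          · subst hx0
            exact hcon.2 (hinj (by simp_all) (by simp_all) (hxa.symm.trans hj01.symm))
          · exact hx1 (hinj (by simp_all) (by simp_all) hxa)
        · rintro (rfl | rfl)
          · exact ⟨hj0, h0⟩
          · refine ⟨hj1', ?_⟩
            rw [← h0]
            ext l
            simp only [Finset.mem_image, Finset.mem_erase]
            constructor
            · rintro ⟨x, ⟨hx, hx'⟩, rfl⟩
              by_cases hx0 : x = j0
              · subst hx0; exact ⟨j, ⟨hx.symm, hj1'⟩, hj01⟩
              · exact ⟨x, ⟨hx0, hx'⟩, rfl⟩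
            · rintro ⟨x, ⟨hx, hx'⟩, rfl⟩
              by_cases hx0 : x = j
              · subst hx0; exact ⟨j0, ⟨hx.symm, hj0⟩, hj01.symm⟩
              · exact ⟨x, ⟨hx0, hx'⟩, rfl⟩
      rw [this, Finset.card_pair hne]; decide
    · rw [Finset.filter_eq_empty_iff.2 (fun j hj h => hex ⟨j, hj, h⟩)]; simp


def upV {m : ℕ} (v τ : Fin m → ℕ) : Fin m → ℕ := fun i => v i + if τ i = 0 then 1 else 0
def upT {m : ℕ} (d : ℕ) (τ : Fin m → ℕ) : Fin m → ℕ :=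
  fun i => if τ i = 0 then d else if τ i ≤ d then τ i - 1 else τ i
def dnV {m : ℕ} (d : ℕ) (v τ : Fin m → ℕ) : Fin m → ℕ := fun i => v i - if τ i = d then 1 else 0
def dnT {m : ℕ} (d : ℕ) (τ : Fin m → ℕ) : Fin m → ℕ :=
  fun i => if τ i = d then 0 else if τ i < d then τ i + 1 else τ i
def swT {m : ℕ} (j : ℕ) (τ : Fin m → ℕ) : Fin m → ℕ :=
  fun i => if τ i = j then j - 1 else if τ i = j - 1 then j else τ i

lemma dn_up_T {m : ℕ} (d : ℕ) (τ : Fin m → ℕ) : dnT d (upT d τ) = τ := by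
  funext i; simp only [dnT, upT]; split_ifs <;> omega
lemma up_dn_T {m : ℕ} (d : ℕ) (τ : Fin m → ℕ) : upT d (dnT d τ) = τ := by
  funext i; grind [dnT, upT]
lemma dn_up_V {m : ℕ} (d : ℕ) (v τ : Fin m → ℕ) : dnV d (upV v τ) (upT d τ) = v := by
  funext i; simp only [dnV, upV, upT]; split_ifs <;> omega
lemma up_dn_V {m : ℕ} (d : ℕ) (v τ : Fin m → ℕ) (h : ∀ i, τ i = d → 1 ≤ v i) :
    upV (dnV d v τ) (dnT d τ) = v := by
  funext i; have := h i; grind [dnV, upV, dnT]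
lemma vert_up {m : ℕ} (d : ℕ) (v τ : Fin m → ℕ) (j : ℕ) (hj : j ≤ d) :
    kVert (upV v τ) (upT d τ) j = kVert v τ (j + 1) := by
  funext i; simp only [kVert, upV, upT]; split_ifs <;> omega
lemma vert_dn {m : ℕ} (d : ℕ) (v τ : Fin m → ℕ) (h : ∀ i, τ i = d → 1 ≤ v i) (j : ℕ) (hj : j ≤ d) :
    kVert (dnV d v τ) (dnT d τ) (j + 1) = kVert v τ j := by
  rw [← vert_up d _ _ j hj, up_dn_V d v τ h, up_dn_T]
lemma vert_sw {m : ℕ} (j : ℕ) (hj : 0 < j) (v τ : Fin m → ℕ) (l : ℕ) (hl : l ≠ j) :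
    kVert v (swT j τ) l = kVert v τ l := by
  funext i; simp only [kVert, swT]; split_ifs <;> omega
lemma sw_sw {m : ℕ} (j : ℕ) (τ : Fin m → ℕ) : swT j (swT j τ) = τ := by
  funext i; simp only [swT]; split_ifs <;> omega
lemma upT_inj {m : ℕ} (d : ℕ) {τ : Fin m → ℕ} (h : Function.Injective τ) :
    Function.Injective (upT d τ) := by
  intro a b hab
  apply h
  simp only [upT] at hab
  split_ifs at hab <;> omega
lemma dnT_inj {m : ℕ} (d : ℕ) {τ : Fin m → ℕ} (h : Function.Injective τ) :
    Function.Injective (dnT d τ) := by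
  intro a b hab
  apply h
  simp only [dnT] at hab
  split_ifs at hab <;> omega
lemma swT_inj {m : ℕ} (j : ℕ) {τ : Fin m → ℕ} (h : Function.Injective τ) :
    Function.Injective (swT j τ) := by
  intro a b hab
  apply h
  simp only [swT] at hab
  split_ifs at hab <;> omega

/-- door opposite to vertex `j` in a cell of dimension `d+1` -/
def kDoor {m : ℕ} (c : (Fin m → ℕ) → ℕ) (d : ℕ) (v τ : Fin m → ℕ) (j : ℕ) : Prop :=
  ((Finset.range (d+2)).erase j).image (fun l => c (kVert v τ l)) = Finset.range (d+1)

def kFull {m : ℕ} (c : (Fin m → ℕ) → ℕ) (d : ℕ) (v τ : Fin m → ℕ) : Prop :=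
  (Finset.range (d+1)).image (fun l => c (kVert v τ l)) = Finset.range (d+1)

lemma kDoor_zero {m : ℕ} (c : (Fin m → ℕ) → ℕ) (d : ℕ) (v τ v' τ' : Fin m → ℕ)
    (h : ∀ j ≤ d, kVert v' τ' j = kVert v τ (j+1)) :
    kDoor c d v τ 0 ↔ kFull c d v' τ' := by
  unfold kDoor kFull
  have : ((Finset.range (d+2)).erase 0).image (fun l => c (kVert v τ l)) =
      (Finset.range (d+1)).image (fun l => c (kVert v' τ' l)) := by
    ext l
    simp only [Finset.mem_image, Finset.mem_erase, Finset.mem_range]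
    constructor
    · rintro ⟨x, ⟨hx, hx'⟩, rfl⟩
      exact ⟨x - 1, by omega, by rw [h _ (by omega)]; congr; omega⟩
    · rintro ⟨x, hx, rfl⟩
      exact ⟨x + 1, ⟨by omega, by omega⟩, by rw [h _ (by omega)]⟩
  rw [this]

lemma kDoor_last {m : ℕ} (c : (Fin m → ℕ) → ℕ) (d : ℕ) (v τ : Fin m → ℕ) :
    kDoor c d v τ (d+1) ↔ kFull c d v τ := by
  unfold kDoor kFull
  have : (Finset.range (d+2)).erase (d+1) = Finset.range (d+1) := by
    ext l; simp; omega
  rw [this]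

lemma kDoor_sw {m : ℕ} (c : (Fin m → ℕ) → ℕ) (d : ℕ) (v τ : Fin m → ℕ) (j : ℕ) (hj : 0 < j) :
    kDoor c d v (swT j τ) j ↔ kDoor c d v τ j := by
  unfold kDoor
  have : ((Finset.range (d+2)).erase j).image (fun l => c (kVert v (swT j τ) l)) =
    ((Finset.range (d+2)).erase j).image (fun l => c (kVert v τ l)) := by
    apply Finset.image_congr
    intro l hl
    simp only [Finset.coe_erase, Set.mem_sdiff, Set.mem_singleton_iff] at hl
    simp only [vert_sw j hj v τ l hl.2]
  rw [this]

open Classical in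
noncomputable def kCells (m M d : ℕ) : Finset ((Fin m → ℕ) × (Fin m → ℕ)) :=
  ((Fintype.piFinset fun _ => Finset.range (M+1)) ×ˢ
    (Fintype.piFinset fun _ => Finset.range m)).filter (fun p => kCell M d p.1 p.2)

lemma mem_kCells {m M d : ℕ} (hd : d ≤ m) (p : (Fin m → ℕ) × (Fin m → ℕ)) :
    p ∈ kCells m M d ↔ kCell M d p.1 p.2 := by
  unfold kCells
  simp only [Finset.mem_filter, Finset.mem_product, Fintype.mem_piFinset, Finset.mem_range]
  constructor
  · exact fun h => h.2
  · intro h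
    refine ⟨⟨fun i => ?_, fun i => ?_⟩, h⟩
    · rcases lt_or_ge (i:ℕ) d with hi | hi
      · have := h.1 i hi; omega
      · have := h.2.1 i hi; omega
    · rcases lt_or_ge (i:ℕ) d with hi | hi
      · have := h.2.2.1 i hi; omega
      · have := h.2.2.2.1 i hi; omega

lemma kVert_le {m M d : ℕ} {v τ : Fin m → ℕ} (h : kCell M d v τ) (j : ℕ) (hj : j ≤ d) (i : Fin m) :
    kVert v τ j i ≤ M := by
  unfold kVert
  rcases lt_or_ge (i:ℕ) d with hi | hi
  · have := h.1 i hi; split_ifs <;> omega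
  · have := h.2.1 i hi; have := h.2.2.2.1 i hi; split_ifs <;> omega

structure KHyp {m : ℕ} (M : ℕ) (c : (Fin m → ℕ) → ℕ) : Prop where
  h0 : ∀ x : Fin m → ℕ, (∀ i, x i ≤ M) → ∀ i, x i = 0 → c x ≠ i
  h1 : ∀ x : Fin m → ℕ, (∀ i, x i ≤ M) → ∀ i, x i = M → c x ≤ i
  hle : ∀ x : Fin m → ℕ, (∀ i, x i ≤ M) → c x ≤ m

lemma label_le {m M d : ℕ} {c : (Fin m → ℕ) → ℕ} (hc : KHyp M c) (hd : d ≤ m) {v τ : Fin m → ℕ}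
    (h : kCell M d v τ) (j : ℕ) (hj : j ≤ d) : c (kVert v τ j) ≤ d := by
  rcases lt_or_eq_of_le hd with hd | rfl
  · refine hc.h1 _ (kVert_le h j hj) ⟨d, hd⟩ ?_
    have h1 := h.2.1 ⟨d, hd⟩ le_rfl
    have h2 := h.2.2.2.1 ⟨d, hd⟩ le_rfl
    simp only at h2
    unfold kVert; rw [h1, h2]; simp; omega
  · exact hc.hle _ (kVert_le h j hj)

open Classical in
lemma k_base {m M : ℕ} {c : (Fin m → ℕ) → ℕ} (hc : KHyp M c) :
    (((kCells m M 0).filter (fun p => kFull c 0 p.1 p.2)).card : ZMod 2) = 1 := by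
  have : (kCells m M 0).filter (fun p => kFull c 0 p.1 p.2) =
      {((fun _ => M, fun i => (i:ℕ)) : (Fin m → ℕ) × (Fin m → ℕ))} := by
    ext ⟨v, τ⟩
    rw [Finset.mem_filter, mem_kCells (Nat.zero_le _), Finset.mem_singleton]
    constructor
    · rintro ⟨h, -⟩
      ext i
      · exact h.2.1 i (Nat.zero_le _)
      · exact h.2.2.2.1 i (Nat.zero_le _)
    · intro h
      have hcell : kCell M 0 v τ := by
        rw [Prod.mk.injEq] at h
        obtain ⟨rfl, rfl⟩ := h
        exact ⟨by simp, by simp, by simp, by simp, fun a b h => Fin.ext h⟩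
      refine ⟨hcell, ?_⟩
      have := label_le hc (Nat.zero_le _) hcell 0 le_rfl
      simp only [Nat.le_zero] at this
      simp [kFull, this]
  rw [this]; simp

open Classical in
lemma k_sum {m M d : ℕ} {c : (Fin m → ℕ) → ℕ} (hc : KHyp M c) (hd : d + 1 ≤ m) :
    (((kCells m M (d+1) ×ˢ Finset.range (d+2)).filter
      (fun q => kDoor c d q.1.1 q.1.2 q.2)).card : ZMod 2) =
    ((kCells m M (d+1)).filter (fun p => kFull c (d+1) p.1 p.2)).card := by
  rw [Finset.card_filter, Finset.sum_product, Finset.card_filter]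
  push_cast
  refine Finset.sum_congr rfl fun p hp => ?_
  rw [mem_kCells hd] at hp
  have := kDoor_parity (d+1) (fun l => c (kVert p.1 p.2 l)) (fun j hj => label_le hc hd hp j hj)
  rw [Finset.card_filter] at this
  push_cast at this
  unfold kFull kDoor
  convert this using 1
  · refine Finset.sum_congr rfl fun x _ => ?_
    congr
  · congr

def kPivot {m : ℕ} (d : ℕ) (q : ((Fin m → ℕ) × (Fin m → ℕ)) × ℕ) :
    ((Fin m → ℕ) × (Fin m → ℕ)) × ℕ :=
  if q.2 = 0 then ((upV q.1.1 q.1.2, upT d q.1.2), d + 1)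
  else if q.2 = d + 1 then ((dnV d q.1.1 q.1.2, dnT d q.1.2), 0)
  else ((q.1.1, swT q.2 q.1.2), q.2)

def kBdry {m : ℕ} (M d : ℕ) (q : ((Fin m → ℕ) × (Fin m → ℕ)) × ℕ) : Prop :=
  q.2 = 0 ∧ ∀ i : Fin m, (i : ℕ) = d → q.1.2 i = 0 ∧ q.1.1 i + 1 = M

lemma door_pos {m M d : ℕ} {c : (Fin m → ℕ) → ℕ} (hc : KHyp M c) {v τ : Fin m → ℕ}
    (h : kCell M (d+1) v τ) (hf : kFull c d v τ) (i : Fin m) (hi : τ i = d) : 1 ≤ v i := by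
  by_contra hv
  have hid : (i : ℕ) < d + 1 := by
    by_contra h'
    have := h.2.2.2.1 i (by omega); omega
  have : (i : ℕ) ∈ Finset.range (d+1) := by simpa using hid
  rw [← hf] at this
  simp only [Finset.mem_image, Finset.mem_range] at this
  obtain ⟨l, hl, hl'⟩ := this
  refine hc.h0 _ (kVert_le h l (by omega)) i ?_ hl'
  unfold kVert; rw [hi]; split_ifs <;> omega

lemma door_lt {m M d : ℕ} {c : (Fin m → ℕ) → ℕ} (hc : KHyp M c) {v τ : Fin m → ℕ}
    (h : kCell M (d+1) v τ) (hf : kDoor c d v τ 0) (i : Fin m) (hi : τ i = 0)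
    (hv : v i + 1 = M) : (i : ℕ) = d := by
  have hid : (i : ℕ) < d + 1 := by
    by_contra h'
    have := h.2.2.2.1 i (by omega); omega
  have : d ∈ Finset.range (d+1) := by simp
  rw [← hf] at this
  simp only [Finset.mem_image, Finset.mem_range, Finset.mem_erase] at this
  obtain ⟨l, hl, hl'⟩ := this
  have := hc.h1 _ (kVert_le h l (by omega)) i (by
    unfold kVert; rw [hi]; split_ifs <;> omega)
  omega

open Classical in
lemma k_rest {m M d : ℕ} {c : (Fin m → ℕ) → ℕ} (hc : KHyp M c) (hd : d + 1 ≤ m) :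
    ((((kCells m M (d+1) ×ˢ Finset.range (d+2)).filter
      (fun q => kDoor c d q.1.1 q.1.2 q.2)).filter (fun q => ¬ kBdry M d q)).card : ZMod 2) = 0 := by
  rw [Finset.card_eq_sum_ones]
  push_cast
  have key : ∀ q : ((Fin m → ℕ) × (Fin m → ℕ)) × ℕ, 
      q ∈ (((kCells m M (d+1) ×ˢ Finset.range (d+2)).filter
      (fun q => kDoor c d q.1.1 q.1.2 q.2)).filter (fun q => ¬ kBdry M d q)) ↔
      (kCell M (d+1) q.1.1 q.1.2 ∧ q.2 < d + 2) ∧ kDoor c d q.1.1 q.1.2 q.2 ∧ ¬ kBdry M d q := by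
    intro q
    rw [Finset.mem_filter, Finset.mem_filter, Finset.mem_product, mem_kCells hd, Finset.mem_range,
      and_assoc]
  refine Finset.sum_involution (fun q _ => kPivot d q) ?_ ?_ ?_ ?_
  · intros; decide
  · rintro ⟨⟨v, τ⟩, j⟩ hq -
    rw [key] at hq
    obtain ⟨⟨hcell, hj⟩, hdoor, -⟩ := hq
    simp only at hcell hj hdoor
    intro heq
    unfold kPivot at heq
    simp only at heq
    split_ifs at heq with h1 h2
    · simp only [Prod.mk.injEq] at heq; omega
    · simp only [Prod.mk.injEq] at heq; omega
    · simp only [Prod.mk.injEq] at heq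
      -- surjectivity of τ onto range m
      have hsurj : ∃ i, τ i = j := by
        have hlt : ∀ i, τ i < m := by
          intro i
          rcases lt_or_ge (i:ℕ) (d+1) with hi | hi
          · have := hcell.2.2.1 i hi; omega
          · have := hcell.2.2.2.1 i hi; omega
        have hs : Function.Surjective (fun i : Fin m => (⟨τ i, hlt i⟩ : Fin m)) := by
          apply Finite.surjective_of_injective
          intro a b hab
          exact hcell.2.2.2.2 (by simpa using hab)
        obtain ⟨i, hi⟩ := hs ⟨j, by omega⟩
        exact ⟨i, by simpa using hi⟩
      obtain ⟨i, hi⟩ := hsurj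
      have := congrFun heq.1.2 i
      simp only [swT, hi, if_true] at this
      omega
  · rintro ⟨⟨v, τ⟩, j⟩ hq
    rw [key] at hq
    rw [key]
    obtain ⟨⟨hcell, hj⟩, hdoor, hb⟩ := hq
    simp only at hcell hj hdoor
    unfold kPivot
    simp only
    split_ifs with h1 h2
    · subst h1
      simp only
      refine ⟨⟨⟨?_, ?_, ?_, ?_, upT_inj d hcell.2.2.2.2⟩, by omega⟩, ?_, ?_⟩
      · intro i hi
        have h1 := hcell.1 i hi
        unfold upV
        split_ifs with h0
        · by_contra hlt
          have hid := door_lt hc hcell hdoor i h0 (by omega)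
          apply hb
          refine ⟨rfl, fun i' hi' => ?_⟩
          have : i' = i := Fin.ext (by omega)
          subst this
          exact ⟨h0, by simp only; omega⟩
        · omega
      · intro i hi
        have h1 := hcell.2.1 i hi
        have h2 := hcell.2.2.2.1 i hi
        unfold upV; split_ifs <;> omega
      · intro i hi
        have h1 := hcell.2.2.1 i hi
        unfold upT; split_ifs <;> omega
      · intro i hi
        have h1 := hcell.2.2.2.1 i hi
        unfold upT; split_ifs <;> omega
      · rw [kDoor_last, ← kDoor_zero c d v τ _ _ (vert_up d v τ)]; exact hdoor
      · rintro ⟨h, -⟩; simp at h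
    · subst h2
      rw [kDoor_last] at hdoor
      have hpos := door_pos hc hcell hdoor
      simp only
      refine ⟨⟨⟨?_, ?_, ?_, ?_, dnT_inj d hcell.2.2.2.2⟩, by omega⟩, ?_, ?_⟩
      · intro i hi
        have h1 := hcell.1 i hi
        unfold dnV
        split_ifs <;> omega
      · intro i hi
        have h1 := hcell.2.1 i hi
        have h2 := hcell.2.2.2.1 i hi
        unfold dnV; split_ifs <;> omega
      · intro i hi
        have h1 := hcell.2.2.1 i hi
        unfold dnT; split_ifs <;> omega
      · intro i hi
        have h1 := hcell.2.2.2.1 i hi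
        unfold dnT; split_ifs <;> omega
      · rw [kDoor_zero c d _ _ v τ (fun l hl => (vert_dn d v τ hpos l hl).symm)]; exact hdoor
      · rintro ⟨-, h⟩
        obtain ⟨ha, hb⟩ := h ⟨d, by omega⟩ rfl
        simp only [dnT, dnV] at ha hb
        have h3 := hcell.1 ⟨d, by omega⟩ (by simp)
        have h4 := hpos ⟨d, by omega⟩
        split_ifs at ha hb <;> omega
    · simp only
      refine ⟨⟨⟨hcell.1, hcell.2.1, ?_, ?_, swT_inj j hcell.2.2.2.2⟩, hj⟩, ?_, ?_⟩
      · intro i hi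
        have h1 := hcell.2.2.1 i hi
        unfold swT; split_ifs <;> omega
      · intro i hi
        have h1 := hcell.2.2.2.1 i hi
        unfold swT; split_ifs <;> omega
      · rw [kDoor_sw _ _ _ _ _ (by omega)]; exact hdoor
      · rintro ⟨h, -⟩; exact h1 h
  · rintro ⟨⟨v, τ⟩, j⟩ hq
    rw [key] at hq
    obtain ⟨⟨hcell, hj⟩, hdoor, hb⟩ := hq
    simp only at hcell hj hdoor
    by_cases h1 : j = 0
    · subst h1; simp [kPivot, dn_up_T, dn_up_V]
    by_cases h2 : j = d + 1
    · subst h2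
      rw [kDoor_last] at hdoor
      have hpos := door_pos hc hcell hdoor
      simp [kPivot, up_dn_T, up_dn_V d v τ hpos]
    · simp [kPivot, h1, h2, sw_sw]

open Classical in
lemma k_bdry {m M d : ℕ} {c : (Fin m → ℕ) → ℕ} (hM : 0 < M) (hd : d + 1 ≤ m) :
    (((kCells m M (d+1) ×ˢ Finset.range (d+2)).filter
      (fun q => kDoor c d q.1.1 q.1.2 q.2)).filter (fun q => kBdry M d q)).card =
    ((kCells m M d).filter (fun p => kFull c d p.1 p.2)).card := by
  refine Finset.card_nbij' (fun q => (upV q.1.1 q.1.2, upT d q.1.2))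
    (fun p => ((dnV d p.1 p.2, dnT d p.2), 0)) ?_ ?_ ?_ ?_
  · rintro ⟨⟨v, τ⟩, j⟩ hq
    rw [SetLike.mem_coe, Finset.mem_filter, Finset.mem_filter, Finset.mem_product, mem_kCells hd] at hq
    obtain ⟨⟨⟨hcell, -⟩, hdoor⟩, hj, hb⟩ := hq
    simp only at hcell hj hdoor hb
    subst hj
    rw [SetLike.mem_coe, Finset.mem_filter, mem_kCells (by omega)]
    obtain ⟨hb1, hb2⟩ := hb ⟨d, by omega⟩ rfl
    refine ⟨⟨?_, ?_, ?_, ?_, upT_inj d hcell.2.2.2.2⟩, ?_⟩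
    · intro i hi
      have h1 := hcell.1 i (by omega)
      simp only [upV]
      split_ifs with h0
      · have := hcell.2.2.2.2 (h0.trans hb1.symm)
        subst this; simp at hi
      · omega
    · intro i hi
      simp only [upV]
      rcases eq_or_lt_of_le hi with hi | hi
      · have : i = ⟨d, by omega⟩ := Fin.ext hi.symm
        rw [this]; simp only [hb1, if_true]; exact hb2
      · have h1 := hcell.2.1 i hi
        have h2 := hcell.2.2.2.1 i hi
        split_ifs <;> omega
    · intro i hi
      have h1 := hcell.2.2.1 i (by omega)
      simp only [upT]
      split_ifs with h0 
      · have := hcell.2.2.2.2 (h0.trans hb1.symm)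
        subst this; simp at hi
      · omega
      · omega
    · intro i hi
      simp only [upT]
      rcases eq_or_lt_of_le hi with hi | hi
      · have : i = ⟨d, by omega⟩ := Fin.ext hi.symm
        rw [this, hb1]; simp
      · have h2 := hcell.2.2.2.1 i hi
        split_ifs <;> omega
    · rw [← kDoor_zero c d v τ _ _ (vert_up d v τ)]; exact hdoor
  · rintro ⟨v, τ⟩ hq
    rw [SetLike.mem_coe, Finset.mem_filter, mem_kCells (by omega)] at hq
    obtain ⟨hcell, hfull⟩ := hq
    simp only at hcell hfull
    rw [SetLike.mem_coe, Finset.mem_filter, Finset.mem_filter, Finset.mem_product, mem_kCells hd]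
    have hτ : ∀ i, τ i = d → (i:ℕ) = d := by
      intro i hi
      rcases lt_or_ge (i:ℕ) d with h | h
      · have := hcell.2.2.1 i h; omega
      · have := hcell.2.2.2.1 i h; omega
    have hpos : ∀ i, τ i = d → 1 ≤ v i := by
      intro i hi
      have := hcell.2.1 i (hτ i hi).ge; omega
    have hd1 := hcell.2.2.2.1 ⟨d, by omega⟩ le_rfl
    have hd2 := hcell.2.1 ⟨d, by omega⟩ le_rfl
    simp only at hd1
    refine ⟨⟨⟨⟨?_, ?_, ?_, ?_, dnT_inj d hcell.2.2.2.2⟩, by simp⟩, ?_⟩, rfl, ?_⟩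
    · intro i hi
      simp only [dnV]
      rcases Nat.lt_succ_iff_lt_or_eq.1 hi with hi | hi
      · have := hcell.1 i hi; split_ifs <;> omega
      · have : i = ⟨d, by omega⟩ := Fin.ext hi
        rw [this]; simp only [hd1, hd2, if_true]; omega
    · intro i hi
      have h1 := hcell.2.1 i (by omega)
      have := hτ i
      simp only [dnV]; split_ifs <;> omega
    · intro i hi
      simp only [dnT]
      rcases Nat.lt_succ_iff_lt_or_eq.1 hi with hi | hi
      · have := hcell.2.2.1 i hi; split_ifs <;> omega
      · have : i = ⟨d, by omega⟩ := Fin.ext hi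
        rw [this, hd1]; simp
    · intro i hi
      have h1 := hcell.2.2.2.1 i (by omega)
      simp only [dnT]; split_ifs <;> omega
    · simp only
      rw [kDoor_zero c d _ _ v τ (fun l hl => (vert_dn d v τ hpos l hl).symm)]; exact hfull
    · intro i hi
      have : i = ⟨d, by omega⟩ := Fin.ext hi
      rw [this]
      simp only [dnT, dnV, hd1, hd2, if_true, true_and]; omega
  · rintro ⟨⟨v, τ⟩, j⟩ hq
    rw [SetLike.mem_coe, Finset.mem_filter] at hq
    have := hq.2.1
    simp only at this
    subst this
    simp only [dn_up_T, dn_up_V]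
  · rintro ⟨v, τ⟩ hq
    rw [SetLike.mem_coe, Finset.mem_filter, mem_kCells (by omega)] at hq
    obtain ⟨hcell, hfull⟩ := hq
    simp only at hcell hfull
    have hpos : ∀ i, τ i = d → 1 ≤ v i := by
      intro i hi
      rcases lt_or_ge (i:ℕ) d with h | h
      · have := hcell.2.2.1 i h; omega
      · have := hcell.2.1 i h; omega
    simp only [up_dn_T, up_dn_V d v τ hpos]

open Classical in
lemma k_odd {m M : ℕ} {c : (Fin m → ℕ) → ℕ} (hM : 0 < M) (hc : KHyp M c) (d : ℕ) (hd : d ≤ m) :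
    (((kCells m M d).filter (fun p => kFull c d p.1 p.2)).card : ZMod 2) = 1 := by
  induction d with
  | zero => exact k_base hc
  | succ d ih =>
    rw [← k_sum hc hd, ← Finset.card_filter_add_card_filter_not (fun q => kBdry M d q)]
    push_cast
    rw [k_rest hc hd, k_bdry hM hd, ih (by omega), add_zero]

lemma kuhn {m M : ℕ} {c : (Fin m → ℕ) → ℕ} (hM : 0 < M) (hc : KHyp M c) :
    ∃ v : Fin m → ℕ, ∀ l ≤ m, ∃ x : Fin m → ℕ, (∀ i, x i ≤ M) ∧ (∀ i, v i ≤ x i ∧ x i ≤ v i + 1) ∧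
      c x = l := by
  classical
  have := k_odd hM hc m le_rfl
  have hne : ((kCells m M m).filter (fun p => kFull c m p.1 p.2)).Nonempty := by
    rw [Finset.nonempty_iff_ne_empty]
    intro h; rw [h] at this; simp at this
  obtain ⟨⟨v, τ⟩, hp⟩ := hne
  rw [Finset.mem_filter, mem_kCells le_rfl] at hp
  obtain ⟨hcell, hfull⟩ := hp
  refine ⟨v, fun l hl => ?_⟩
  have : l ∈ Finset.range (m+1) := by simp; omega
  rw [← hfull] at this
  simp only [Finset.mem_image, Finset.mem_range] at this
  obtain ⟨j, hj, rfl⟩ := this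
  refine ⟨kVert v τ j, kVert_le hcell j (by omega), fun i => ?_, rfl⟩
  unfold kVert; split_ifs <;> omega


lemma lebesgue_cover {m : ℕ} {ι : Type*} (W : ι → Set (Fin m → ℝ)) (hW : ∀ a, IsOpen (W a))
    (hcov : ∀ t, ∃ a, t ∈ W a) (D : ℝ)
    (hD : ∀ a, ∀ t ∈ W a, ∀ t' ∈ W a, ∀ i, |t i - t' i| ≤ D) :
    ∃ (t : Fin m → ℝ) (a : Fin (m+1) → ι), Function.Injective a ∧ ∀ l, t ∈ W (a l) := by
  classical
  obtain ⟨N, hN0, hND⟩ : ∃ N : ℝ, 0 < N ∧ D < N := ⟨max D 0 + 1, by positivity, by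
    have := le_max_left D 0; linarith⟩
  have hK : IsCompact (Icc (0 : Fin m → ℝ) (fun _ => N)) := isCompact_Icc
  obtain ⟨δ, hδ, hball⟩ := lebesgue_number_lemma_of_metric hK hW
    (fun t _ => mem_iUnion.2 (hcov t))
  obtain ⟨M, hM⟩ := exists_nat_gt (N / δ)
  have hMpos : (0:ℝ) < M := lt_trans (by positivity) hM
  have hM0 : 0 < M := by exact_mod_cast hMpos
  set P : (Fin m → ℕ) → (Fin m → ℝ) := fun x i => N * x i / M with hP
  have hPK : ∀ x : Fin m → ℕ, (∀ i, x i ≤ M) → P x ∈ Icc (0 : Fin m → ℝ) (fun _ => N) := by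
    intro x hx
    refine ⟨fun i => by simp only [hP, Pi.zero_apply]; positivity, fun i => ?_⟩
    simp only [hP]
    rw [div_le_iff₀ hMpos]
    have : (x i : ℝ) ≤ M := by exact_mod_cast hx i
    nlinarith
  have hsel : ∀ x : Fin m → ℕ, ∃ a, (∀ i, x i ≤ M) → Metric.ball (P x) δ ⊆ W a := by
    intro x
    by_cases hx : ∀ i, x i ≤ M
    · obtain ⟨a, ha⟩ := hball _ (hPK x hx)
      exact ⟨a, fun _ => ha⟩
    · obtain ⟨a, -⟩ := hcov 0
      exact ⟨a, fun h => absurd h hx⟩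
  choose A hA using hsel
  have hmem : ∀ x : Fin m → ℕ, (∀ i, x i ≤ M) → P x ∈ W (A x) := fun x hx =>
    hA x hx (Metric.mem_ball_self hδ)
  -- colour of a member
  set Q : ι → ℕ → Prop := fun a j => j = m ∨ ∃ h : j < m, ∀ t ∈ W a, t ⟨j, h⟩ ≠ 0 with hQ
  have hQe : ∀ a, ∃ j, Q a j := fun a => ⟨m, Or.inl rfl⟩
  set κ : ι → ℕ := fun a => Nat.find (hQe a) with hκ
  have hc : KHyp M (fun x => κ (A x)) := by
    refine ⟨?_, ?_, ?_⟩
    · intro x hx i hi heq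
      have h1 := Nat.find_spec (hQe (A x))
      change Q (A x) (κ (A x)) at h1
      rw [heq] at h1
      rcases h1 with h1 | ⟨h, h1⟩
      · have := i.2; omega
      · apply h1 _ (hmem x hx)
        simp [hP, hi]
    · intro x hx i hi
      apply Nat.find_min' (hQe (A x))
      refine Or.inr ⟨i.2, fun t ht h0 => ?_⟩
      have := hD _ _ (hmem x hx) t ht i
      have h0' : t i = 0 := h0
      have h2 : P x i = N := by simp only [hP, hi]; field_simp
      rw [h0', h2, sub_zero, abs_of_pos hN0] at this
      linarith
    · intro x hx
      exact Nat.find_min' (hQe (A x)) (Or.inl rfl)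
  obtain ⟨v, hv⟩ := kuhn hM0 hc
  choose! x hx1 hx2 hx3 using hv
  refine ⟨P (x 0), fun l => A (x l), ?_, ?_⟩
  · intro l l' h
    have h1 := hx3 l (by omega)
    have h2 := hx3 l' (by omega)
    simp only at h h1 h2
    rw [h] at h1
    exact Fin.ext (h1.symm.trans h2)
  · intro l
    apply hA _ (hx1 l (by omega))
    rw [Metric.mem_ball, dist_pi_lt_iff hδ]
    intro i
    have h1 := hx2 0 (by omega) i
    have h2 := hx2 l (by omega) i
    have h3 : |((x 0 i : ℝ) - x l i)| ≤ 1 := by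
      rw [abs_le]
      have a1 : (x 0 i : ℝ) ≤ v i + 1 := by exact_mod_cast h1.2
      have a2 : (v i : ℝ) ≤ x 0 i := by exact_mod_cast h1.1
      have a3 : (x l i : ℝ) ≤ v i + 1 := by exact_mod_cast h2.2
      have a4 : (v i : ℝ) ≤ x l i := by exact_mod_cast h2.1
      constructor <;> linarith
    rw [Real.dist_eq]
    have h4 : P (x 0) i - P (x l) i = N / M * ((x 0 i : ℝ) - x l i) := by
      simp only [hP]; ring
    rw [h4, abs_mul, abs_of_pos (by positivity)]
    have h5 : N / M < δ := by
      rw [div_lt_iff₀ hMpos]; rw [div_lt_iff₀ hδ] at hM; linarith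
    have : N / M * |((x 0 i : ℝ) - x l i)| ≤ N / M * 1 := by gcongr
    linarith


section geom
variable {X : Type*} [MetricSpace X]

lemma geod_compare (hX : IsCAT0 X) {y z z' : X} {γ γ' : ℝ → X} (h : IsGeodSeg y z γ)
    (h' : IsGeodSeg y z' γ') {u : ℝ} (hu : u ∈ Icc (0:ℝ) 1) :
    dist (γ u) (γ' u) ≤ u * dist z z' := by
  have e1 := hX.2 (γ u) y z' γ' h' u hu
  have e2 := hX.2 z' y z γ h u hu
  have e3 : dist (γ u) y = u * dist y z := by
    rw [← h.1, h.2.2 u hu 0 ⟨le_rfl, zero_le_one⟩, h.1, sub_zero, abs_of_nonneg hu.1]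
  rw [e3] at e1
  rw [dist_comm z' (γ u)] at e2
  rw [dist_comm z' y, dist_comm z' z] at e2
  apply abs_le_of_sq_le_sq' _ (mul_nonneg hu.1 dist_nonneg) |>.2
  have := mul_le_mul_of_nonneg_left e2 hu.1
  nlinarith

lemma geod_rev {y z : X} {γ : ℝ → X} (h : IsGeodSeg y z γ) :
    IsGeodSeg z y (fun u => γ (1 - u)) := by
  refine ⟨by simp [h.2.1], by simp [h.1], ?_⟩
  intro s hs t ht
  simp only
  rw [h.2.2 (1-s) ⟨by linarith [hs.2], by linarith [hs.1]⟩ (1-t) ⟨by linarith [ht.2], by linarith [ht.1]⟩,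
    dist_comm z y, show 1 - s - (1 - t) = t - s by ring, abs_sub_comm]

lemma geod_iso {y z : X} {γ : ℝ → X} (h : IsGeodSeg y z γ) (f : X ≃ᵢ X) :
    IsGeodSeg (f y) (f z) (fun u => f (γ u)) := by
  refine ⟨by simp [h.1], by simp [h.2.1], ?_⟩
  intro s hs t ht
  simp only [f.dist_eq]
  exact h.2.2 s hs t ht

lemma geod_compare2 (hX : IsCAT0 X) {y z y' z' : X} {γ γ' : ℝ → X} (h : IsGeodSeg y z γ)
    (h' : IsGeodSeg y' z' γ') {u : ℝ} (hu : u ∈ Icc (0:ℝ) 1) :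
    dist (γ u) (γ' u) ≤ dist y y' + dist z z' := by
  obtain ⟨η, hη⟩ := hX.1 y z'
  have h1 := geod_compare hX h hη hu
  have hu' : 1 - u ∈ Icc (0:ℝ) 1 := ⟨by linarith [hu.2], by linarith [hu.1]⟩
  have h2 := geod_compare hX (geod_rev hη) (geod_rev h') hu'
  simp only [sub_sub_cancel] at h2
  have h3 := dist_triangle (γ u) (η u) (γ' u)
  have a1 : u * dist z z' ≤ 1 * dist z z' := by gcongr; exact hu.2
  have a2 : (1 - u) * dist y y' ≤ 1 * dist y y' := by gcongr; exact hu'.2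
  linarith

lemma quad_ineq (hX : IsCAT0 X) (y z p q : X) :
    dist y q ^ 2 + dist z p ^ 2 ≤
      dist y p ^ 2 + dist z q ^ 2 + dist y z ^ 2 + dist p q ^ 2 := by
  obtain ⟨γ, hγ⟩ := hX.1 y q
  have hh : (1/2 : ℝ) ∈ Icc (0:ℝ) 1 := by constructor <;> norm_num
  have e1 := hX.2 p y q γ hγ (1/2) hh
  have e2 := hX.2 z y q γ hγ (1/2) hh
  have e3 := dist_triangle z (γ (1/2)) p
  rw [dist_comm (γ (1/2)) p] at e3
  rw [dist_comm p y] at e1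
  rw [dist_comm z y] at e2
  have e4 : dist z p ^ 2 ≤ (dist z (γ (1/2)) + dist p (γ (1/2))) ^ 2 := by
    gcongr
  nlinarith [sq_nonneg (dist z (γ (1/2)) - dist p (γ (1/2)))]

lemma disp_double (hX : IsCAT0 X) (f : X ≃ᵢ X) {r : ℝ} (hr : ∀ y, r ≤ dist y (f y)) (y : X) :
    2 * r ≤ dist y (f (f y)) := by
  obtain ⟨γ, hγ⟩ := hX.1 y (f y)
  have hh : (1/2 : ℝ) ∈ Icc (0:ℝ) 1 := by constructor <;> norm_num
  have h := geod_compare hX (geod_rev hγ) (geod_iso hγ f) hh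
  rw [show (1 - 1/2 : ℝ) = 1/2 by norm_num] at h
  have := hr (γ (1/2))
  linarith

lemma disp_pow (hX : IsCAT0 X) {G : Type*} [Group G] (ρ : G →* (X ≃ᵢ X)) (j : ℕ) :
    ∀ (σ : G) {r : ℝ}, (∀ y, r ≤ dist y (ρ σ y)) → ∀ y, 2 ^ j * r ≤ dist y (ρ (σ ^ (2 ^ j)) y) := by
  induction j with
  | zero => intro σ r hr y; simpa using hr y
  | succ j ih =>
    intro σ r hr y
    have h2 : ∀ y, 2 * r ≤ dist y (ρ (σ ^ 2) y) := by
      intro y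
      have := disp_double hX (ρ σ) hr y
      rw [pow_two, map_mul]; exact this
    have := ih (σ ^ 2) h2 y
    rw [← pow_mul] at this
    rw [pow_succ' (2:ℕ) j, pow_succ (2:ℝ) j]
    linarith

lemma axis_dist (hX : IsCAT0 X) {G : Type*} [Group G] (ρ : G →* (X ≃ᵢ X)) (σ : G) (x : X)
    (hx : ∀ y, dist x (ρ σ x) ≤ dist y (ρ σ y)) (n : ℕ) :
    dist x (ρ (σ ^ n) x) = n * dist x (ρ σ x) := by
  have hup : ∀ n : ℕ, dist x (ρ (σ ^ n) x) ≤ n * dist x (ρ σ x) := by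
    intro n
    induction n with
    | zero => simp
    | succ n ih =>
      have h1 := dist_triangle x (ρ (σ ^ n) x) (ρ (σ ^ (n+1)) x)
      have h2 : dist (ρ (σ ^ n) x) (ρ (σ ^ (n+1)) x) = dist x (ρ σ x) := by
        rw [pow_succ, map_mul]; exact (ρ (σ ^ n)).dist_eq _ _
      push_cast; linarith
  refine le_antisymm (hup n) ?_
  have hlt : n ≤ 2 ^ n := Nat.lt_two_pow_self.le
  obtain ⟨e, he⟩ := Nat.exists_eq_add_of_le hlt
  have h1 := disp_pow hX ρ n σ hx x
  have h2 := dist_triangle x (ρ (σ ^ n) x) (ρ (σ ^ (2 ^ n)) x)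
  have h3 : dist (ρ (σ ^ n) x) (ρ (σ ^ (2 ^ n)) x) = dist x (ρ (σ ^ e) x) := by
    rw [he, pow_add, map_mul]; exact (ρ (σ ^ n)).dist_eq _ _
  have h4 := hup e
  have h5 : (2:ℝ) ^ n = n + e := by exact_mod_cast he
  rw [h5] at h1
  linarith

/-- Busemann function data for an axial isometry. -/
lemma busemann (hX : IsCAT0 X) {G : Type*} [Group G] (ρ : G →* (X ≃ᵢ X)) (σ : G) (x : X)
    (hx : ∀ y, dist x (ρ σ x) ≤ dist y (ρ σ y)) (hpos : 0 < dist x (ρ σ x)) :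
    ∃ b : X → ℝ, (∀ y z, |b y - b z| ≤ dist y z) ∧ (∀ y, b (ρ σ y) = b y - dist x (ρ σ x)) ∧
      ∀ h : G, Commute σ h → ∀ y z, b (ρ h y) - b y = b (ρ h z) - b z := by
  set r := dist x (ρ σ x) with hr
  set p : ℕ → X := fun n => ρ (σ ^ n) x with hp
  have hd : ∀ n, dist x (p n) = n * r := axis_dist hX ρ σ x hx
  have hstep : ∀ n, dist (p n) (p (n+1)) = r := by
    intro n
    simp only [hp]; rw [pow_succ, map_mul]; exact (ρ (σ ^ n)).dist_eq _ _
  set B : X → ℕ → ℝ := fun y n => dist y (p n) - n * r with hB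
  have hanti : ∀ y, Antitone (B y) := by
    intro y
    refine antitone_nat_of_succ_le fun n => ?_
    simp only [hB]
    have := dist_triangle y (p n) (p (n+1))
    rw [hstep] at this
    push_cast; linarith
  have hlow : ∀ y n, - dist y x ≤ B y n := by
    intro y n
    simp only [hB]
    have := dist_triangle x y (p n)
    rw [hd, dist_comm x y] at this
    linarith
  have hhigh : ∀ y n, B y n ≤ dist y x := by
    intro y n
    simp only [hB]
    have := dist_triangle y x (p n)
    rw [hd] at this
    linarith
  have hlim : ∀ y, ∃ l, Filter.Tendsto (B y) Filter.atTop (nhds l) := fun y =>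
    ⟨_, tendsto_atTop_ciInf (hanti y) ⟨- dist y x, by rintro _ ⟨n, rfl⟩; exact hlow y n⟩⟩
  choose b hb using hlim
  refine ⟨b, ?_, ?_, ?_⟩
  · intro y z
    refine le_of_tendsto ((hb y).sub (hb z)).abs (Filter.Eventually.of_forall fun n => ?_)
    simp only [hB]
    rw [sub_sub_sub_cancel_right]
    exact abs_dist_sub_le y z (p n)
  · intro y
    have h1 : Filter.Tendsto (fun n => B (ρ σ y) (n+1)) Filter.atTop (nhds (b (ρ σ y))) :=
      (Filter.tendsto_add_atTop_iff_nat 1).2 (hb _)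
    have h2 : (fun n => B (ρ σ y) (n+1)) = fun n => B y n - r := by
      funext n
      simp only [hB, hp]
      rw [pow_succ', map_mul]
      have : dist (ρ σ y) ((ρ σ * ρ (σ ^ n)) x) = dist y (ρ (σ ^ n) x) := (ρ σ).dist_eq _ _
      rw [this]; push_cast; ring
    rw [h2] at h1
    exact tendsto_nhds_unique h1 ((hb y).sub_const r)
  · intro h hcomm y z
    -- the difference tends to zero
    have hlimdiff : Filter.Tendsto (fun n => (B (ρ h y) n - B y n) - (B (ρ h z) n - B z n))
        Filter.atTop (nhds ((b (ρ h y) - b y) - (b (ρ h z) - b z))) :=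
      ((hb _).sub (hb _)).sub ((hb _).sub (hb _))
    obtain ⟨K, hK⟩ : ∃ K : ℝ, ∀ n : ℕ,
        |(dist (ρ h y) (p n) ^ 2 - dist y (p n) ^ 2) - (dist (ρ h z) (p n) ^ 2 - dist z (p n) ^ 2)| ≤ K := by
      refine ⟨dist y z ^ 2 + dist x (ρ h⁻¹ x) ^ 2, fun n => ?_⟩
      have hq : ∀ w, dist (ρ h w) (p n) = dist w (ρ (σ ^ n) (ρ h⁻¹ x)) := by
        intro w
        have e1 : ρ h (ρ (σ ^ n) (ρ h⁻¹ x)) = p n := by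
          simp only [hp]
          have : h * (σ ^ n * h⁻¹) = σ ^ n := by
            rw [← mul_assoc, ← (hcomm.pow_left n).eq, mul_assoc, mul_inv_cancel, mul_one]
          change (ρ h * (ρ (σ ^ n) * ρ h⁻¹)) x = ρ (σ ^ n) x
          rw [← map_mul, ← map_mul, this]
        rw [← e1, (ρ h).dist_eq]
      have hpq : dist (p n) (ρ (σ ^ n) (ρ h⁻¹ x)) = dist x (ρ h⁻¹ x) := (ρ (σ ^ n)).dist_eq _ _
      rw [hq y, hq z]
      have q1 := quad_ineq hX y z (p n) (ρ (σ ^ n) (ρ h⁻¹ x))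
      have q2 := quad_ineq hX z y (p n) (ρ (σ ^ n) (ρ h⁻¹ x))
      rw [hpq] at q1 q2
      rw [dist_comm z y] at q2
      rw [abs_le]; constructor <;> linarith
    -- conversion
    have hbd : ∀ w, ∃ K, ∀ n, |B w n ^ 2| ≤ K := by
      intro w
      refine ⟨dist w x ^ 2, fun n => ?_⟩
      rw [abs_of_nonneg (sq_nonneg _)]
      exact sq_le_sq' (hlow w n) (hhigh w n)
    obtain ⟨K1, hK1⟩ := hbd (ρ h y)
    obtain ⟨K2, hK2⟩ := hbd y
    obtain ⟨K3, hK3⟩ := hbd (ρ h z)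
    obtain ⟨K4, hK4⟩ := hbd z
    have hzero : Filter.Tendsto (fun n => (B (ρ h y) n - B y n) - (B (ρ h z) n - B z n))
        Filter.atTop (nhds 0) := by
      refine squeeze_zero_norm' (a := fun n : ℕ => ((K + K1 + K2 + K3 + K4) / (2 * r)) / n) ?_ 
        (tendsto_const_div_atTop_nhds_zero_nat _)
      filter_upwards [Filter.eventually_gt_atTop 0] with n hn
      have hn' : (0:ℝ) < n := by exact_mod_cast hn
      rw [Real.norm_eq_abs, le_div_iff₀ hn', le_div_iff₀ (by positivity)]
      have hsq : ∀ w, dist w (p n) ^ 2 = (n * r) ^ 2 + 2 * (n * r) * B w n + B w n ^ 2 := by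
        intro w; simp only [hB]; ring
      have k0 := hK n
      rw [hsq, hsq, hsq, hsq] at k0
      have k1 := hK1 n
      have k2 := hK2 n
      have k3 := hK3 n
      have k4 := hK4 n
      rw [mul_assoc, ← abs_of_pos (show 0 < (n:ℝ) * (2 * r) by positivity), ← abs_mul]
      rw [abs_le] at *
      constructor <;> linarith [k0.1, k0.2, k1.1, k1.2, k2.1, k2.2, k3.1, k3.2, k4.1, k4.2]
    have := tendsto_nhds_unique hlimdiff hzero
    linarith

end geom


section interp
variable {X : Type*} [MetricSpace X]

lemma geod_continuousOn (hX : IsCAT0 X) {Gd : X → X → ℝ → X} (hGd : ∀ y z, IsGeodSeg y z (Gd y z))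
    {T : Type*} [TopologicalSpace T] {f₁ f₂ : T → X} {u : T → ℝ} (h₁ : Continuous f₁)
    (h₂ : Continuous f₂) (hu : Continuous u) {S : Set T} (hS : ∀ t ∈ S, u t ∈ Icc (0:ℝ) 1) :
    ContinuousOn (fun t => Gd (f₁ t) (f₂ t) (u t)) S := by
  intro t₀ ht₀
  change Filter.Tendsto _ _ _
  rw [tendsto_iff_dist_tendsto_zero]
  have hlim : Filter.Tendsto (fun t => dist (f₁ t) (f₁ t₀) + dist (f₂ t) (f₂ t₀) +
      |u t - u t₀| * dist (f₁ t₀) (f₂ t₀)) (nhdsWithin t₀ S) (nhds 0) := by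
    have : Continuous (fun t => dist (f₁ t) (f₁ t₀) + dist (f₂ t) (f₂ t₀) +
      |u t - u t₀| * dist (f₁ t₀) (f₂ t₀)) := by fun_prop
    have h := this.continuousWithinAt (s := S) (x := t₀)
    have h' := h.tendsto
    simpa using h'
  refine squeeze_zero' (Filter.Eventually.of_forall fun _ => dist_nonneg) ?_ hlim
  filter_upwards [self_mem_nhdsWithin] with t ht
  have e1 := geod_compare2 hX (hGd (f₁ t) (f₂ t)) (hGd (f₁ t₀) (f₂ t₀)) (hS t ht)
  have e2 := (hGd (f₁ t₀) (f₂ t₀)).2.2 (u t) (hS t ht) (u t₀) (hS t₀ ht₀)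
  have e3 := dist_triangle (Gd (f₁ t) (f₂ t) (u t)) (Gd (f₁ t₀) (f₂ t₀) (u t))
    (Gd (f₁ t₀) (f₂ t₀) (u t₀))
  linarith

lemma locFin_Icc : LocallyFinite (fun n : ℤ => Icc (n:ℝ) (n+1)) := by
  intro x
  refine ⟨Metric.ball x 1, Metric.ball_mem_nhds x one_pos, ?_⟩
  refine (Set.finite_Icc (⌊x⌋ - 3) (⌊x⌋ + 3)).subset ?_
  rintro n ⟨y, hy, hyx⟩
  rw [Metric.mem_ball, Real.dist_eq, abs_lt] at hyx
  have h1 := Int.floor_le x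
  have h2 := Int.lt_floor_add_one x
  have h3 : ((⌊x⌋ - 3 : ℤ) : ℝ) ≤ n := by push_cast; linarith [hy.1, hy.2]
  have h4 : (n : ℝ) ≤ ((⌊x⌋ + 3 : ℤ) : ℝ) := by push_cast; linarith [hy.1, hy.2]
  exact ⟨by exact_mod_cast h3, by exact_mod_cast h4⟩

lemma interp (hX : IsCAT0 X) {G : Type*} [Group G] (ρ : G →* (X ≃ᵢ X)) (e : ℕ → G)
    (hcomm : ∀ i j, Commute (e i) (e j)) (x₀ : X) (j : ℕ) :
    ∃ F : (ℕ → ℝ) → X, Continuous F ∧ (∀ l, ∃ C, ∀ t, dist (F t) (ρ (e l) (F t)) ≤ C) ∧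
      ∀ (b : X → ℝ) (c : ℕ → ℝ), (∀ y z, |b y - b z| ≤ dist y z) →
        (∀ l y, b (ρ (e l) y) = b y + c l) →
        ∃ C, ∀ t, |b (F t) - ∑ l ∈ Finset.range j, c l * t l| ≤ C := by
  induction j with
  | zero =>
    refine ⟨fun _ => x₀, continuous_const, fun l => ⟨_, fun _ => le_rfl⟩, fun b c _ _ => ⟨|b x₀|, ?_⟩⟩
    intro t; simp
  | succ j ih =>
    obtain ⟨F, hF, hdisp, hbF⟩ := ih
    choose Gd hGd using hX.1
    have hfl : ∀ t : ℝ, Int.fract t ∈ Icc (0:ℝ) 1 := fun t =>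
      ⟨Int.fract_nonneg t, (Int.fract_lt_one t).le⟩
    obtain ⟨Cj, hCj⟩ := hdisp j
    set w : (ℕ → ℝ) → X := fun t => Gd (F t) (ρ (e j) (F t)) (Int.fract (t j)) with hw
    have hwF : ∀ t, dist (F t) (w t) ≤ Cj := by
      intro t
      have h1 := (hGd (F t) (ρ (e j) (F t))).2.2 0 ⟨le_rfl, zero_le_one⟩ _ (hfl (t j))
      rw [(hGd (F t) (ρ (e j) (F t))).1, zero_sub, abs_neg, abs_of_nonneg (hfl _).1] at h1
      have h2 : Int.fract (t j) * dist (F t) (ρ (e j) (F t)) ≤ 1 * dist (F t) (ρ (e j) (F t)) := by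
        gcongr; exact (hfl _).2
      simp only [hw]
      rw [h1]; linarith [hCj t]
    refine ⟨fun t => ρ (e j ^ ⌊t j⌋) (w t), ?_, ?_, ?_⟩
    · have hlf : LocallyFinite (fun n : ℤ => (fun t : ℕ → ℝ => t j) ⁻¹' (Icc (n:ℝ) (n+1))) :=
        locFin_Icc.preimage_continuous (continuous_apply j)
      refine hlf.continuous ?_ (fun n => isClosed_Icc.preimage (continuous_apply j)) ?_
      · rw [eq_univ_iff_forall]
        intro t
        rw [mem_iUnion]
        exact ⟨⌊t j⌋, Int.floor_le _, (Int.lt_floor_add_one _).le⟩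
      · intro n
        have hcont : ContinuousOn (fun t : ℕ → ℝ =>
            ρ (e j ^ n) (Gd (F t) (ρ (e j) (F t)) (t j - n)))
            ((fun t : ℕ → ℝ => t j) ⁻¹' (Icc (n:ℝ) (n+1))) := by
          refine (ρ (e j ^ n)).continuous.comp_continuousOn ?_
          have hu : Continuous (fun t : ℕ → ℝ => t j - (n:ℝ)) := by fun_prop
          refine geod_continuousOn hX hGd hF ((ρ (e j)).continuous.comp hF) hu ?_
          intro t ht
          have h1 : (n:ℝ) ≤ t j := ht.1
          have h2 : t j ≤ n + 1 := ht.2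
          exact ⟨sub_nonneg.2 h1, by linarith⟩
        refine hcont.congr ?_
        intro t ht
        simp only [hw]
        rcases eq_or_lt_of_le ht.2 with h | h
        · have h' : t j = ((n + 1 : ℤ) : ℝ) := by push_cast; exact h
          have hf : ⌊t j⌋ = n + 1 := by rw [h']; exact Int.floor_intCast _
          have hfr : Int.fract (t j) = 0 := by rw [h']; exact Int.fract_intCast _
          have hs : t j - n = 1 := by simp only at h; linarith
          rw [hf, hfr, hs, (hGd _ _).1, (hGd _ _).2.1, zpow_add, zpow_one, map_mul]
          rfl
        · have hf : ⌊t j⌋ = n := by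
            rw [Int.floor_eq_iff]; exact ⟨ht.1, h⟩
          rw [hf, Int.fract, hf]
    · intro l
      obtain ⟨Cl, hCl⟩ := hdisp l
      refine ⟨Cj + Cl + Cj, fun t => ?_⟩
      have h1 : ρ (e l) (ρ (e j ^ ⌊t j⌋) (w t)) = ρ (e j ^ ⌊t j⌋) (ρ (e l) (w t)) := by
        change (ρ (e l) * ρ (e j ^ ⌊t j⌋)) (w t) = (ρ (e j ^ ⌊t j⌋) * ρ (e l)) (w t)
        rw [← map_mul, ← map_mul, ((hcomm l j).zpow_right _).eq]
      simp only
      rw [h1, (ρ _).dist_eq]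
      have h2 := dist_triangle4 (w t) (F t) (ρ (e l) (F t)) (ρ (e l) (w t))
      rw [(ρ (e l)).dist_eq, dist_comm (w t) (F t)] at h2
      linarith [hwF t, hCl t]
    · intro b c hb hbc
      obtain ⟨C, hC⟩ := hbF b c hb hbc
      have hnat : ∀ (n : ℕ) y, b (ρ (e j ^ n) y) = b y + n * c j := by
        intro n
        induction n with
        | zero => intro y; simp
        | succ n ih =>
          intro y
          rw [pow_succ', map_mul]
          change b (ρ (e j) (ρ (e j ^ n) y)) = _
          rw [hbc, ih]; push_cast; ring
      have hint : ∀ (n : ℤ) y, b (ρ (e j ^ n) y) = b y + n * c j := by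
        intro n y
        obtain ⟨a, rfl | rfl⟩ := n.eq_nat_or_neg
        · rw [zpow_natCast, hnat]; simp
        · have h := hnat a (ρ (e j ^ (-(a:ℤ))) y)
          have h2 : ρ (e j ^ a) (ρ (e j ^ (-(a:ℤ))) y) = y := by
            change (ρ (e j ^ a) * ρ (e j ^ (-(a:ℤ)))) y = y
            rw [← map_mul, zpow_neg, zpow_natCast, mul_inv_cancel, map_one]; rfl
          rw [h2] at h
          push_cast; linarith
      refine ⟨C + Cj + |c j|, fun t => ?_⟩
      simp only
      rw [hint, Finset.sum_range_succ]
      have h1 := hC t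
      have h2 := (hb (w t) (F t)).trans ((dist_comm _ _).le.trans (hwF t))
      have h3 : |c j * Int.fract (t j)| ≤ |c j| := by
        rw [abs_mul, abs_of_nonneg (hfl _).1]
        exact mul_le_of_le_one_right (abs_nonneg _) (hfl _).2
      have h4 : b (w t) + ⌊t j⌋ * c j - (∑ l ∈ Finset.range j, c l * t l + c j * t j) =
          (b (F t) - ∑ l ∈ Finset.range j, c l * t l) + (b (w t) - b (F t)) - c j * Int.fract (t j) := by
        rw [Int.fract]; ring
      rw [h4]
      rw [abs_le] at *
      constructor <;> linarith [h1.1, h1.2, h2.1, h2.2, h3.1, h3.2]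

lemma matrix_bound {m : ℕ} (A : Matrix (Fin m) (Fin m) ℝ) (hA : A.det ≠ 0) (K : ℝ) :
    ∃ D : ℝ, ∀ v : Fin m → ℝ, (∀ i, |A.mulVec v i| ≤ K) → ∀ i, |v i| ≤ D := by
  refine ⟨∑ i, ∑ l, |A⁻¹ i l| * K, fun v hv i => ?_⟩
  have h1 : A⁻¹.mulVec (A.mulVec v) = v := by
    rw [Matrix.mulVec_mulVec, Matrix.nonsing_inv_mul _ (isUnit_iff_ne_zero.2 hA), Matrix.one_mulVec]
  have hK : 0 ≤ K := (abs_nonneg _).trans (hv i)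
  calc |v i| = |∑ l, A⁻¹ i l * A.mulVec v l| := by
        conv_lhs => rw [← h1]
        rfl
    _ ≤ ∑ l, |A⁻¹ i l * A.mulVec v l| := Finset.abs_sum_le_sum_abs _ _
    _ ≤ ∑ l, |A⁻¹ i l| * K := by
        refine Finset.sum_le_sum fun l _ => ?_
        rw [abs_mul]; gcongr; exact hv l
    _ ≤ _ := Finset.single_le_sum (f := fun i => ∑ l, |A⁻¹ i l| * K)
        (fun i _ => Finset.sum_nonneg fun l _ => by positivity) (Finset.mem_univ i)

lemma covDim_dimLE {k : ℕ} (h : covDim X = (k : ℕ∞)) : DimLE X k := by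
  unfold covDim at h
  have hne : {d : ℕ∞ | ∃ n : ℕ, d = (n : ℕ∞) ∧ DimLE X n}.Nonempty := by
    rw [Set.nonempty_iff_ne_empty]
    intro he
    rw [he, sInf_empty] at h
    exact ENat.natCast_ne_top k h.symm
  obtain ⟨n, hn, hd⟩ := csInf_mem hne
  rw [h] at hn
  have : k = n := by exact_mod_cast hn
  rwa [this]

lemma supp_commute {G A : Type*} [Group G] [MulAction G A] [FaithfulSMul G A] (H : Subgroup G)
    (g : G) (hd : (g • groupSupp A H) ∩ groupSupp A H = ∅) (h h' : G) (hh : h ∈ H) (hh' : h' ∈ H) :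
    Commute (g * h' * g⁻¹) h := by
  have hinv : ∀ p ∈ H, ∀ a ∈ groupSupp A H, p • a ∈ groupSupp A H := by
    rintro p hp a ⟨q, hq, hqa⟩
    refine ⟨p * q * p⁻¹, H.mul_mem (H.mul_mem hp hq) (H.inv_mem hp), ?_⟩
    rw [mul_smul, mul_smul, inv_smul_smul]
    exact fun he => hqa (smul_left_cancel p he)
  have hfix : ∀ p ∈ H, ∀ a, a ∉ groupSupp A H → p • a = a := by
    intro p hp a ha
    by_contra hne
    exact ha ⟨p, hp, hne⟩
  have hfix' : ∀ a, a ∉ g • groupSupp A H → (g * h' * g⁻¹) • a = a := by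
    intro a ha
    rw [Set.mem_smul_set_iff_inv_smul_mem] at ha
    rw [mul_smul, mul_smul, hfix h' hh' _ ha, smul_inv_smul]
  have hinv' : ∀ a ∈ g • groupSupp A H, (g * h' * g⁻¹) • a ∈ g • groupSupp A H := by
    intro a ha
    rw [Set.mem_smul_set_iff_inv_smul_mem] at ha ⊢
    rw [mul_smul, mul_smul, inv_smul_smul]
    exact hinv h' hh' _ ha
  have hdis : ∀ a ∈ groupSupp A H, a ∉ g • groupSupp A H := by
    intro a ha ha'
    have : a ∈ (g • groupSupp A H) ∩ groupSupp A H := ⟨ha', ha⟩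
    rw [hd] at this; exact this
  apply FaithfulSMul.eq_of_smul_eq_smul (α := A)
  intro a
  rw [mul_smul (g * h' * g⁻¹), mul_smul h]
  by_cases ha : a ∈ groupSupp A H
  · rw [hfix' _ (hdis _ (hinv h hh a ha)), hfix' _ (hdis _ ha)]
  · rw [hfix h hh a ha]
    by_cases ha' : a ∈ g • groupSupp A H
    · rw [hfix h hh _ (fun hc => hdis _ hc (hinv' a ha'))]
    · rw [hfix' a ha', hfix h hh a ha]

end interp

/-- Theorem 1.1: the fixed-point criterion.  Let `G` act faithfully on a set `A` and let
`s ∈ G` admit a chain `⟨s⟩ = H₀ < H₁ < ⋯ < H_k < H_{k+1} = G` with elements `gᵢ ∈ H_{i+1}`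
(`1 ≤ i ≤ k`) such that every homomorphism `Hᵢ → ℝ` is trivial and
`gᵢ(supp Hᵢ) ∩ supp Hᵢ = ∅`.  Then for every complete CAT(0) space `X` of topological
dimension `k` and every semi-simple isometric action of `G` on `X`, `s` has a fixed point. -/
theorem fixed_point_criterion
    {G A : Type*} [Group G] [MulAction G A] [FaithfulSMul G A]
    (s : G) (k : ℕ) (H : ℕ → Subgroup G) (g : ℕ → G)
    (hH0 : H 0 = Subgroup.zpowers s)
    (hHtop : H (k + 1) = ⊤)
    (hchain : ∀ i ≤ k, H i < H (i + 1))
    (hgmem : ∀ i, 1 ≤ i → i ≤ k → g i ∈ H (i + 1))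
    (hhom : ∀ i, 1 ≤ i → i ≤ k → ∀ φ : H i →* Multiplicative ℝ, ∀ h, φ h = 1)
    (hdisj : ∀ i, 1 ≤ i → i ≤ k →
      (g i • groupSupp A (H i)) ∩ groupSupp A (H i) = ∅)
    (X : Type*) [MetricSpace X] [CompleteSpace X]
    (hX : IsCAT0 X) (hdim : covDim X = (k : ℕ∞))
    (ρ : G →* (X ≃ᵢ X)) (hss : SemiSimpleAction ρ) :
    ∃ x : X, ρ s x = x := by
  by_contra hfix
  push Not at hfix
  have hmono : ∀ j, j ≤ k + 1 → ∀ i ≤ j, H i ≤ H j := by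
    intro j
    induction j with
    | zero => intro _ i hi; rw [Nat.le_zero.1 hi]
    | succ n ih =>
      intro hn i hi
      rcases Nat.lt_or_ge i (n+1) with h | h
      · exact (ih (by omega) i (by omega)).trans (hchain n (by omega)).le
      · rw [le_antisymm hi h]
  have hs : ∀ i ≤ k + 1, s ∈ H i := by
    intro i hi
    apply hmono i hi 0 (Nat.zero_le _)
    rw [hH0]
    exact Subgroup.mem_zpowers s
  let g' : ℕ → G := fun i => if i = 0 then 1 else g i
  let e : ℕ → G := fun i => if i ≤ k then g' i * s * (g' i)⁻¹ else 1
  have he : ∀ i ≤ k, e i = g' i * s * (g' i)⁻¹ := fun i hi => if_pos hi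
  have hg' : ∀ i, 1 ≤ i → g' i = g i := fun i hi => if_neg (by omega)
  have he_mem : ∀ i ≤ k, e i ∈ H (i+1) := by
    intro i hi
    rw [he i hi]
    have : g' i ∈ H (i+1) := by
      rcases Nat.eq_zero_or_pos i with h | h
      · subst h
        exact (H 1).one_mem
      · rw [hg' i h]; exact hgmem i h hi
    exact (H _).mul_mem ((H _).mul_mem this (hs _ (by omega))) ((H _).inv_mem this)
  have he_comm : ∀ i, 1 ≤ i → i ≤ k → ∀ h ∈ H i, Commute (e i) h := by
    intro i hi hik h hh
    rw [he i hik, hg' i hi]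
    exact supp_commute (H i) (g i) (hdisj i hi hik) h s hh (hs i (by omega))
  have he_lt : ∀ i j, i < j → Commute (e i) (e j) := by
    intro i j hij
    by_cases hj : j ≤ k
    · exact (he_comm j (by omega) hj _ (hmono j (by omega) (i+1) hij (he_mem i (by omega)))).symm
    · have : e j = 1 := if_neg hj
      rw [this]; exact Commute.one_right _
  have hcomm : ∀ i j, Commute (e i) (e j) := by
    intro i j
    rcases lt_trichotomy i j with h | h | h
    · exact he_lt i j h
    · rw [h]
    · exact (he_lt j i h).symm
  have hB : ∀ i : Fin (k+1), ∃ (b : X → ℝ) (c : ℕ → ℝ), (∀ y z, |b y - b z| ≤ dist y z) ∧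
      (∀ l y, b (ρ (e l) y) = b y + c l) ∧ c i ≠ 0 ∧ ∀ l < (i : ℕ), c l = 0 := by
    intro i
    have hik : (i : ℕ) ≤ k := by omega
    obtain ⟨x, hx⟩ := hss (e i)
    have hpos : 0 < dist x (ρ (e i) x) := by
      rw [dist_pos]
      intro hxe
      apply hfix (ρ (g' i)⁻¹ x)
      rw [he i hik] at hxe
      have h2 := congrArg (ρ (g' i)⁻¹) hxe
      rw [← IsometryEquiv.mul_apply, ← map_mul] at h2
      rw [← IsometryEquiv.mul_apply, ← map_mul, h2]
      congr 2
      group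
    obtain ⟨b, hb1, hb2, hb3⟩ := busemann hX ρ (e i) x hx hpos
    refine ⟨b, fun l => b (ρ (e l) x) - b x, hb1, ?_, ?_, ?_⟩
    · intro l y
      have := hb3 (e l) (hcomm i l) y x
      linarith
    · change b (ρ (e i) x) - b x ≠ 0
      rw [hb2 x]
      intro h
      linarith
    · intro l hl
      have hi1 : 1 ≤ (i : ℕ) := by omega
      let φ : H i →* Multiplicative ℝ :=
        { toFun := fun h => Multiplicative.ofAdd (b (ρ h x) - b x)
          map_one' := by simp
          map_mul' := by
            intro p q
            rw [← ofAdd_add]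
            congr 1
            have h3 := hb3 p (he_comm i hi1 hik p p.2) (ρ q x) x
            rw [Subgroup.coe_mul, map_mul, IsometryEquiv.mul_apply]
            linarith }
      have hφ := hhom i hi1 hik φ ⟨e l, hmono i (by omega) (l+1) hl (he_mem l (by omega))⟩
      exact Multiplicative.ofAdd.injective hφ
  choose b c hb1 hb2 hcne hc0 using hB
  obtain ⟨x₀, -⟩ := hss 1
  obtain ⟨F, hF, -, hFb⟩ := interp hX ρ e hcomm x₀ (k+1)
  have hC : ∀ i, ∃ C, ∀ t, |b i (F t) - ∑ l ∈ Finset.range (k+1), c i l * t l| ≤ C :=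
    fun i => hFb (b i) (c i) (hb1 i) (hb2 i)
  choose C hC using hC
  let M : Matrix (Fin (k+1)) (Fin (k+1)) ℝ := fun i l => c i l
  have hM : M.det ≠ 0 := by
    rw [Matrix.det_of_isUpperTriangular (M := M)]
    · exact Finset.prod_ne_zero_iff.2 fun i _ => hcne i
    · intro i j hij
      exact hc0 i j hij
  obtain ⟨D, hD⟩ := matrix_bound M hM (2 + 2 * ∑ i, |C i|)
  obtain ⟨𝒱, hVo, hVc, hVr, hVn⟩ := covDim_dimLE hdim
    (Set.range fun x : X => Metric.ball x 1)
    (by rintro _ ⟨x, rfl⟩; exact Metric.isOpen_ball)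
    (by
      rw [Set.eq_univ_iff_forall]
      intro x
      exact ⟨_, ⟨x, rfl⟩, Metric.mem_ball_self one_pos⟩)
  let ext : (Fin (k+1) → ℝ) → (ℕ → ℝ) := fun t n => if h : n < k+1 then t ⟨n, h⟩ else 0
  have hext : Continuous ext := by
    refine continuous_pi fun n => ?_
    by_cases h : n < k+1
    · simp only [ext, h, dite_true]; exact continuous_apply _
    · simp only [ext, h, dite_false]; exact continuous_const
  have hsum : ∀ i t, ∑ l ∈ Finset.range (k+1), c i l * ext t l = M.mulVec t i := by
    intro i t
    rw [Finset.sum_range]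
    simp only [Matrix.mulVec, dotProduct, M]
    refine Finset.sum_congr rfl fun l _ => ?_
    have h : ext t l = t l := dif_pos l.2
    rw [h]
  obtain ⟨t, a, hinj, hta⟩ := lebesgue_cover (m := k+1)
    (fun V : 𝒱 => {t | F (ext t) ∈ (V : Set X)})
    (fun V => (hVo V V.2).preimage (hF.comp hext))
    (by
      intro t
      have : F (ext t) ∈ ⋃₀ 𝒱 := by rw [hVc]; trivial
      obtain ⟨V, hV, hm⟩ := this
      exact ⟨⟨V, hV⟩, hm⟩)
    D
    (by
      intro V t ht t' ht' i
      obtain ⟨U, ⟨x, rfl⟩, hU⟩ := hVr V V.2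
      have d1 : dist (F (ext t)) x < 1 := hU ht
      have d2 : dist (F (ext t')) x < 1 := hU ht'
      have d3 : dist (F (ext t)) (F (ext t')) ≤ 2 := by
        have := dist_triangle_right (F (ext t)) (F (ext t')) x
        linarith
      refine hD (t - t') (fun i => ?_) i
      have h1 := hC i (ext t)
      have h2 := hC i (ext t')
      have h3 := hb1 i (F (ext t)) (F (ext t'))
      rw [hsum] at h1 h2
      have h4 : |C i| ≤ ∑ i, |C i| :=
        Finset.single_le_sum (f := fun i => |C i|) (fun j _ => abs_nonneg _) (Finset.mem_univ i)
      have h5 := le_abs_self (C i)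
      rw [Matrix.mulVec_sub, Pi.sub_apply]
      rw [abs_le] at h1 h2 h3 ⊢
      constructor <;> linarith [h1.1, h1.2, h2.1, h2.2, h3.1, h3.2])
  have hle := hVn (F (ext t))
  have hsub : Set.range (fun l => (a l : Set X)) ⊆ {V | V ∈ 𝒱 ∧ F (ext t) ∈ V} := by
    rintro _ ⟨l, rfl⟩
    exact ⟨(a l).2, hta l⟩
  have hinj' : Function.Injective (fun l => (a l : Set X)) := Subtype.val_injective.comp hinj
  have h1 := (Set.encard_le_encard hsub).trans hle
  rw [← Set.image_univ, hinj'.encard_image, Set.encard_univ, ENat.card_eq_coe_fintype_card,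
    Fintype.card_fin] at h1
  have h2 : k + 1 + 1 ≤ k + 1 := by exact_mod_cast h1
  omega
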